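/- arXiv:1210.1311 — 3 statements merged into one kernel-verified Lean document; each statement's English description precedes it below -/
import Mathlib

section
/- Let σ : A* → A* be a primitive substitution that is left proper (with letter l, so σ(a) = l·u(a) for all a ∈ A) and let τ be its left conjugate (τ(a) = u(a)·l). Then the compositions σ∘τ and τ∘σ are proper primitive substitutions, i.e., each is primitive and is simultaneously left proper and right proper. (The same conclusion holds when σ is right proper and τ is its right conjugate.) -/
/-- The extension of a morphism `σ` (given by its values on letters) to words,
acting by concatenation. -/
def wordApply {A B : Type*} (σ : A → List B) (w : List A) : List B :=
  (w.map σ).flatten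

/-- Composition of endomorphisms of the free monoid: `(σ ∘ τ)(x) = σ(τ(x))`. -/
def compMor {A : Type*} (σ τ : A → List A) : A → List A :=
  fun x => wordApply σ (τ x)

/-- `σ` is left proper: every image starts with a common letter `l`. -/
def LeftProper {A : Type*} (σ : A → List A) : Prop :=
  ∃ l : A, ∀ x : A, ∃ u : List A, σ x = l :: u

/-- `σ` is right proper: every image ends with a common letter `r`. -/
def RightProper {A : Type*} (σ : A → List A) : Prop :=
  ∃ r : A, ∀ x : A, ∃ u : List A, σ x = u ++ [r]

/-- `σ` is primitive: there is `n ≥ 1` such that every letter `b` occurs in `σⁿ(a)`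
for every letter `a`. -/
def Primitive {A : Type*} (σ : A → List A) : Prop :=
  ∃ n : ℕ, 1 ≤ n ∧ ∀ a b : A, b ∈ (wordApply σ)^[n] [a]

theorem wordApply_compMor {A : Type*} (σ τ : A → List A) (w : List A) :
    wordApply (compMor σ τ) w = wordApply σ (wordApply τ w) := by
  induction w with
  | nil => rfl
  | cons a w ih => simp_all [wordApply, compMor]

theorem mem_wordApply {A B : Type*} {σ : A → List B} {w : List A} {b : B} :
    b ∈ wordApply σ w ↔ ∃ a ∈ w, b ∈ σ a := by
  simp [wordApply]

theorem wordApply_subset_wordApply {A B : Type*} {σ τ : A → List B} {v w : List A}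
    (hστ : ∀ x, σ x ⊆ τ x) (hvw : v ⊆ w) : wordApply σ v ⊆ wordApply τ w := by
  intro b hb
  obtain ⟨a, ha, hba⟩ := mem_wordApply.1 hb
  exact mem_wordApply.2 ⟨a, hvw ha, hστ a hba⟩

theorem iterate_wordApply_subset {A : Type*} {σ τ : A → List A} {v w : List A}
    (hστ : ∀ x, σ x ⊆ τ x) (hvw : v ⊆ w) (n : ℕ) :
    (wordApply σ)^[n] v ⊆ (wordApply τ)^[n] w := by
  induction n with
  | zero => exact hvw
  | succ n ih =>
    rw [Function.iterate_succ_apply', Function.iterate_succ_apply']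
    exact wordApply_subset_wordApply hστ ih

theorem Primitive.mono {A : Type*} {σ τ : A → List A} (hστ : ∀ x, σ x ⊆ τ x)
    (hσ : Primitive σ) : Primitive τ := by
  obtain ⟨n, hn, h⟩ := hσ
  exact ⟨n, hn, fun a b => iterate_wordApply_subset hστ (List.Subset.refl _) n (h a b)⟩

theorem Primitive.compMor_self {A : Type*} {σ : A → List A} (hσ : Primitive σ) :
    Primitive (compMor σ σ) := by
  obtain ⟨n, hn, h⟩ := hσ
  refine ⟨n, hn, fun a b => ?_⟩
  have hsq : wordApply (compMor σ σ) = (wordApply σ)^[2] :=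
    funext fun w => wordApply_compMor σ σ w
  rw [hsq, ← Function.iterate_mul, two_mul, Function.iterate_add_apply]
  have ha : [a] ⊆ (wordApply σ)^[n] [a] := by simpa using h a a
  exact iterate_wordApply_subset (fun _ => List.Subset.refl _) ha n (h a b)

theorem Primitive.compMor_of_subset {A : Type*} {σ τ ρ : A → List A} (hρ : Primitive ρ)
    (hσ : ∀ x, ρ x ⊆ σ x) (hτ : ∀ x, ρ x ⊆ τ x) : Primitive (compMor σ τ) :=
  hρ.compMor_self.mono fun x => wordApply_subset_wordApply hσ (hτ x)

theorem LeftProper.ne_nil {A : Type*} {σ : A → List A} (hσ : LeftProper σ) (x : A) :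
    σ x ≠ [] := by
  obtain ⟨l, h⟩ := hσ
  obtain ⟨u, hu⟩ := h x
  simp [hu]

theorem RightProper.ne_nil {A : Type*} {σ : A → List A} (hσ : RightProper σ) (x : A) :
    σ x ≠ [] := by
  obtain ⟨r, h⟩ := hσ
  obtain ⟨u, hu⟩ := h x
  simp [hu]

theorem LeftProper.compMor_of_ne_nil {A : Type*} {σ τ : A → List A} (hσ : LeftProper σ)
    (hτ : ∀ x, τ x ≠ []) : LeftProper (compMor σ τ) := by
  obtain ⟨l, h⟩ := hσ
  refine ⟨l, fun x => ?_⟩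
  obtain ⟨a, v, hv⟩ := List.exists_cons_of_ne_nil (hτ x)
  obtain ⟨u, hu⟩ := h a
  exact ⟨u ++ wordApply σ v, by simp [compMor, wordApply, hv, hu]⟩

theorem LeftProper.ne_nil_compMor {A : Type*} {σ τ : A → List A} (hτ : LeftProper τ)
    (hσ : ∀ x, σ x ≠ []) : LeftProper (compMor σ τ) := by
  obtain ⟨l, h⟩ := hτ
  obtain ⟨a, v, hv⟩ := List.exists_cons_of_ne_nil (hσ l)
  refine ⟨a, fun x => ?_⟩
  obtain ⟨u, hu⟩ := h x
  exact ⟨v ++ wordApply σ u, by simp [compMor, wordApply, hv, hu]⟩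

theorem RightProper.compMor_of_ne_nil {A : Type*} {σ τ : A → List A} (hσ : RightProper σ)
    (hτ : ∀ x, τ x ≠ []) : RightProper (compMor σ τ) := by
  obtain ⟨r, h⟩ := hσ
  refine ⟨r, fun x => ?_⟩
  obtain ⟨v, a, hv⟩ := (List.eq_nil_or_concat' (τ x)).resolve_left (hτ x)
  obtain ⟨u, hu⟩ := h a
  exact ⟨wordApply σ v ++ u, by simp [compMor, wordApply, hv, hu]⟩

theorem RightProper.ne_nil_compMor {A : Type*} {σ τ : A → List A} (hτ : RightProper τ)
    (hσ : ∀ x, σ x ≠ []) : RightProper (compMor σ τ) := by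
  obtain ⟨r, h⟩ := hτ
  obtain ⟨v, a, hv⟩ := (List.eq_nil_or_concat' (σ r)).resolve_left (hσ r)
  refine ⟨a, fun x => ?_⟩
  obtain ⟨u, hu⟩ := h x
  exact ⟨wordApply σ u ++ v, by simp [compMor, wordApply, hv, hu]⟩

/-- Let `σ` be a primitive substitution which is left proper, with `σ(x) = l · u(x)`
for all letters `x`, and let `τ(x) = u(x) · l` be its left conjugate (respectively,
`σ(x) = u(x) · r` right proper with right conjugate `τ(x) = r · u(x)`).  Then `σ ∘ τ`
and `τ ∘ σ` are proper (both left and right proper) primitive substitutions. -/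
theorem comp_conjugate_proper_primitive {A : Type*} [Fintype A]
    (σ τ : A → List A) (hprim : Primitive σ)
    (hconj :
      (∃ (l : A) (u : A → List A),
        (∀ x : A, σ x = l :: u x) ∧ (∀ x : A, τ x = u x ++ [l])) ∨
      (∃ (r : A) (u : A → List A),
        (∀ x : A, σ x = u x ++ [r]) ∧ (∀ x : A, τ x = r :: u x))) :
    (Primitive (compMor σ τ) ∧ LeftProper (compMor σ τ) ∧ RightProper (compMor σ τ)) ∧
    (Primitive (compMor τ σ) ∧ LeftProper (compMor τ σ) ∧ RightProper (compMor τ σ)) := by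
  have hsub : ∀ x, σ x ⊆ τ x := by
    rcases hconj with ⟨l, u, hσ, hτ⟩ | ⟨r, u, hσ, hτ⟩ <;> intro x b hb <;>
      simp only [hσ, hτ, List.mem_cons, List.mem_append, List.not_mem_nil, or_false] at hb ⊢ <;>
      exact hb.symm
  refine ⟨⟨hprim.compMor_of_subset (fun _ => List.Subset.refl _) hsub, ?_⟩,
    ⟨hprim.compMor_of_subset hsub (fun _ => List.Subset.refl _), ?_⟩⟩
  all_goals rcases hconj with ⟨l, u, hσ, hτ⟩ | ⟨r, u, hσ, hτ⟩
  · have hσ' : LeftProper σ := ⟨l, fun x => ⟨u x, hσ x⟩⟩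
    have hτ' : RightProper τ := ⟨l, fun x => ⟨u x, hτ x⟩⟩
    exact ⟨hσ'.compMor_of_ne_nil hτ'.ne_nil, hτ'.ne_nil_compMor hσ'.ne_nil⟩
  · have hσ' : RightProper σ := ⟨r, fun x => ⟨u x, hσ x⟩⟩
    have hτ' : LeftProper τ := ⟨r, fun x => ⟨u x, hτ x⟩⟩
    exact ⟨hτ'.ne_nil_compMor hσ'.ne_nil, hσ'.compMor_of_ne_nil hτ'.ne_nil⟩
  · have hσ' : LeftProper σ := ⟨l, fun x => ⟨u x, hσ x⟩⟩
    have hτ' : RightProper τ := ⟨l, fun x => ⟨u x, hτ x⟩⟩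
    exact ⟨hσ'.ne_nil_compMor hτ'.ne_nil, hτ'.compMor_of_ne_nil hσ'.ne_nil⟩
  · have hσ' : RightProper σ := ⟨r, fun x => ⟨u x, hσ x⟩⟩
    have hτ' : LeftProper τ := ⟨r, fun x => ⟨u x, hτ x⟩⟩
    exact ⟨hτ'.compMor_of_ne_nil hσ'.ne_nil, hσ'.ne_nil_compMor hτ'.ne_nil⟩
end

section
/- Let (X, T) be the minimal non-periodic S-adic subshift defined by a sequence (σ_n : A_n* → A_{n-1}*, a_n ∈ A_n)_{n≥2} of proper morphisms such that each σ_n extends by concatenation to a one-to-one map from X_n into X_{n-1}, and set τ_n = σ_2 ∘ ⋯ ∘ σ_n. Then the intersection ⋂_{n≥2} ⋃_{c ∈ A_n} τ_n([c]_{X_{n+1}}) consists of exactly one point of X. -/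
/-- The factor `x_i x_{i+1} ⋯ x_{i+m-1}` of a biinfinite sequence `x`. -/
def seg {A : Type*} (x : ℤ → A) (i : ℤ) (m : ℕ) : List A :=
  (List.range m).map fun k => x (i + k)

/-- The shift by `p` on biinfinite sequences; `shiftBy 1` is the shift map `T`. -/
def shiftBy {A : Type*} (p : ℤ) (x : ℤ → A) : ℤ → A :=
  fun i => x (i + p)

/-- A morphism is proper if all its images begin with a common letter `l` and end with
a common letter `r`. -/
def ProperMorphism {B C : Type*} (σ : B → List C) : Prop :=
  ∃ l r : C, ∀ x : B, (σ x).head? = some l ∧ (σ x).getLast? = some r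

/-- Given a directive sequence of morphisms `σ n : A (n+1)* → A n*`, the composition
`σ 0 ∘ σ 1 ∘ ⋯ ∘ σ (k-1)` applied to a letter of `A k`. -/
def down {A : ℕ → Type*} (σ : ∀ n, A (n + 1) → List (A n)) : ∀ k, A k → List (A 0)
  | 0, c => [c]
  | k + 1, c => ((σ k c).map (down σ k)).flatten

/-- The subshift `X n ⊆ (A n)^ℤ` generated by the directive sequence
`(σ m, a m)_{m ≥ n}` : the set of sequences all of whose finite factors occur in some
word `σ n ∘ σ (n+1) ∘ ⋯ ∘ σ (n+k-1) (a (n+k))`. -/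
def XX {A : ℕ → Type*} (σ : ∀ n, A (n + 1) → List (A n)) (a : ∀ n, A n) (n : ℕ) :
    Set (ℤ → A n) :=
  { x | ∀ (i : ℤ) (m : ℕ), ∃ k : ℕ,
      seg x i m <:+: down (A := fun j => A (n + j)) (fun j => σ (n + j)) k (a (n + k)) }

/-- Cumulative length function: `cum f k` is the (signed) sum of `f` over the interval
between `0` and `k`. -/
def cum (f : ℤ → ℕ) : ℤ → ℤ
  | Int.ofNat n => ∑ i ∈ Finset.range n, (f i : ℤ)
  | Int.negSucc n => -∑ i ∈ Finset.range (n + 1), (f (Int.negSucc i) : ℤ)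

/-- `ExtSeq σ y z` expresses that `z` is the image of the biinfinite sequence `y`
under the concatenation extension of the morphism `σ`, i.e.
`z = ⋯ σ(y_{-1}) . σ(y_0) σ(y_1) ⋯` with `σ(y_0)` starting at coordinate `0`. -/
def ExtSeq {B C : Type*} (σ : B → List C) (y : ℤ → B) (z : ℤ → C) : Prop :=
  ∀ k : ℤ, seg z (cum (fun j => (σ (y j)).length) k) (σ (y k)).length = σ (y k)

/-- The atom `T^j τ_k([c]_{X (k)})` of the partition `P`, where
`τ_k = σ 0 ∘ ⋯ ∘ σ (k-1)` : the set of points of the form `T^j τ_k(y)` with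
`y ∈ X k` and `y 0 = c`. -/
def Atom {A : ℕ → Type*} (σ : ∀ n, A (n + 1) → List (A n)) (a : ∀ n, A n)
    (k : ℕ) (c : A k) (j : ℕ) : Set (ℤ → A 0) :=
  { x | ∃ (y : ℤ → A k) (z : ℤ → A 0), y ∈ XX σ a k ∧ y 0 = c ∧
      ExtSeq (down σ k) y z ∧ x = shiftBy (j : ℤ) z }

open Topology

/-! ### Factors of biinfinite sequences -/

section Factors

variable {B : Type*}

lemma seg_eq_map (x : ℤ → B) (i : ℤ) (m : ℕ) :
    seg x i m = (List.range m).map fun k : ℕ => x (i + k) := by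
  simp [seg, ← List.map_eq_flatMap]

@[simp] lemma length_seg (x : ℤ → B) (i : ℤ) (m : ℕ) : (seg x i m).length = m := by
  simp [seg_eq_map]

lemma getElem_seg (x : ℤ → B) (i : ℤ) (m j : ℕ) (h : j < (seg x i m).length) :
    (seg x i m)[j] = x (i + j) := by
  simp [seg_eq_map]

lemma seg_add (x : ℤ → B) (i : ℤ) (m n : ℕ) :
    seg x i (m + n) = seg x i m ++ seg x (i + m) n := by
  simp [seg_eq_map, List.range_add, Function.comp_def, add_assoc]

@[simp] lemma seg_one (x : ℤ → B) (i : ℤ) : seg x i 1 = [x i] := by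
  simp [seg_eq_map]

@[simp] lemma seg_zero (x : ℤ → B) (i : ℤ) : seg x i 0 = [] := by
  simp [seg_eq_map]

lemma seg_shiftBy (x : ℤ → B) (p i : ℤ) (m : ℕ) :
    seg (shiftBy p x) i m = seg x (i + p) m := by
  simp [seg_eq_map, shiftBy, add_right_comm]

lemma seg_const (b : B) (i : ℤ) (m : ℕ) : seg (fun _ => b) i m = List.replicate m b := by
  simp [seg_eq_map]

lemma seg_infix_seg (x : ℤ → B) {i i' : ℤ} {m m' : ℕ} (h : i' ≤ i)
    (h' : i + m ≤ i' + m') : seg x i m <:+: seg x i' m' := by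
  obtain ⟨u, rfl⟩ : ∃ u : ℕ, i = i' + u := ⟨(i - i').toNat, by omega⟩
  obtain ⟨v, rfl⟩ : ∃ v : ℕ, m' = u + m + v := ⟨m' - (u + m), by omega⟩
  exact ⟨seg x i' u, seg x (i' + ↑(u + m)) v, by rw [seg_add, seg_add]⟩

lemma eq_of_seg_eq {x x' : ℤ → B} {i : ℤ} {m : ℕ} (h : seg x i m = seg x' i m)
    {t : ℤ} (ht : i ≤ t) (ht' : t < i + m) : x t = x' t := by
  obtain ⟨u, rfl⟩ : ∃ u : ℕ, t = i + u := ⟨(t - i).toNat, by omega⟩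
  have hu : u < m := by omega
  rw [← getElem_seg x i m u (by simpa using hu), ← getElem_seg x' i m u (by simpa using hu)]
  simp only [h]

lemma exists_seg_eq [Nonempty B] (w : List B) (i : ℤ) : ∃ z, seg z i w.length = w := by
  inhabit B
  refine ⟨fun t => w.getD (t - i).toNat default, List.ext_getElem (by simp) fun j h h' => ?_⟩
  rw [getElem_seg]
  simp [h']

end Factors

/-! ### Cumulative lengths -/

section Cum

@[simp] lemma cum_zero (f : ℤ → ℕ) : cum f 0 = 0 := by
  change cum f (Int.ofNat 0) = 0
  simp [cum]

lemma cum_add_one (f : ℤ → ℕ) (k : ℤ) : cum f (k + 1) = cum f k + f k := by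
  match k with
  | Int.ofNat n =>
    change cum f (Int.ofNat (n + 1)) = _
    simp [cum, Finset.sum_range_succ]
  | Int.negSucc 0 =>
    change cum f (Int.ofNat 0) = _
    simp [cum]
  | Int.negSucc (n + 1) =>
    change cum f (Int.negSucc n) = _
    simp only [cum, Finset.sum_range_succ _ (n + 1)]
    ring

lemma cum_congr {f g : ℤ → ℕ} {k : ℤ} (h : ∀ j ∈ Finset.Icc (-|k|) |k|, f j = g j) :
    cum f k = cum g k := by
  match k with
  | Int.ofNat n =>
    refine Finset.sum_congr rfl fun i hi => ?_
    rw [h]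
    have := Finset.mem_range.1 hi
    simp only [Int.ofNat_eq_natCast, Finset.mem_Icc, Nat.abs_cast]
    omega
  | Int.negSucc n =>
    refine congrArg Neg.neg (Finset.sum_congr rfl fun i hi => ?_)
    rw [h]
    have := Finset.mem_range.1 hi
    simp only [Finset.mem_Icc, abs_of_neg (Int.negSucc_lt_zero n)]
    omega

lemma strictMono_cum {f : ℤ → ℕ} (hf : ∀ j, 0 < f j) : StrictMono (cum f) :=
  strictMono_int_of_lt_succ fun k => by
    have := hf k
    rw [cum_add_one]
    omega

lemma exists_eq_cum_add {f : ℤ → ℕ} (hf : ∀ j, 0 < f j) (i : ℤ) :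
    ∃ k, ∃ j < f k, i = cum f k + j := by
  induction i using Int.induction_on with
  | zero => exact ⟨0, 0, hf 0, by simp⟩
  | succ i ih =>
    obtain ⟨k, j, hj, h⟩ := ih
    by_cases hlt : j + 1 < f k
    · exact ⟨k, j + 1, hlt, by push_cast; omega⟩
    · refine ⟨k + 1, 0, hf _, ?_⟩
      rw [cum_add_one]
      push_cast
      omega
  | pred i ih =>
    obtain ⟨k, j, hj, h⟩ := ih
    rcases j with _ | j
    · have h1 := cum_add_one f (k - 1)
      have h2 := hf (k - 1)
      rw [sub_add_cancel] at h1
      exact ⟨k - 1, f (k - 1) - 1, by omega, by omega⟩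
    · exact ⟨k, j, by omega, by omega⟩

lemma eq_of_cum_add_eq {f : ℤ → ℕ} (hf : ∀ j, 0 < f j) {k k' : ℤ} {j j' : ℕ}
    (hj : j < f k) (hj' : j' < f k') (h : cum f k + j = cum f k' + j') :
    k = k' ∧ j = j' := by
  have hk : k = k' := by
    rcases lt_trichotomy k k' with hlt | heq | hlt
    · have := (strictMono_cum hf).monotone (Int.add_one_le_of_lt hlt)
      rw [cum_add_one] at this
      omega
    · exact heq
    · have := (strictMono_cum hf).monotone (Int.add_one_le_of_lt hlt)
      rw [cum_add_one] at this
      omega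
  subst hk
  exact ⟨rfl, by omega⟩

end Cum

/-! ### Extension of morphisms by concatenation -/

section Extension

variable {B C D : Type*}

@[simp] lemma wordApply_nil (τ : C → List D) : wordApply τ [] = [] := rfl

@[simp] lemma wordApply_cons (τ : C → List D) (c : C) (w : List C) :
    wordApply τ (c :: w) = τ c ++ wordApply τ w := rfl

@[simp] lemma wordApply_append (τ : C → List D) (u v : List C) :
    wordApply τ (u ++ v) = wordApply τ u ++ wordApply τ v := by
  simp [wordApply]

lemma length_le_length_wordApply {τ : C → List D} (hτ : ∀ c, τ c ≠ []) (w : List C) :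
    w.length ≤ (wordApply τ w).length := by
  induction w with
  | nil => simp
  | cons c w ih =>
    have := List.length_pos_iff.2 (hτ c)
    simp only [List.length_cons, wordApply_cons, List.length_append]
    omega

lemma length_wordApply_le {τ : C → List D} {M : ℕ} (hM : ∀ c, (τ c).length ≤ M)
    (w : List C) : (wordApply τ w).length ≤ M * w.length := by
  induction w with
  | nil => simp
  | cons c w ih =>
    have := hM c
    simp only [List.length_cons, wordApply_cons, List.length_append]
    linarith

lemma wordApply_wordApply {τ : C → List D} {σ : B → List C} (w : List B) :
    wordApply τ (wordApply σ w) = wordApply (fun b => wordApply τ (σ b)) w := by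
  induction w with
  | nil => rfl
  | cons b w ih => simp [ih]

lemma exists_extSeq {τ : C → List D} (hτ : ∀ c, τ c ≠ []) (y : ℤ → C) :
    ∃ z, ExtSeq τ y z := by
  have hf : ∀ j, 0 < (τ (y j)).length := fun j => List.length_pos_iff.2 (hτ _)
  choose k j hj h using exists_eq_cum_add hf
  refine ⟨fun i => (τ (y (k i)))[j i]'(hj i), fun m => List.ext_getElem (by simp) ?_⟩
  intro t _ ht
  rw [getElem_seg]
  obtain ⟨h1, h2⟩ := eq_of_cum_add_eq hf ht (hj _) (h (cum _ m + t))
  simp only [← h1, ← h2]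

lemma ExtSeq.unique {τ : C → List D} (hτ : ∀ c, τ c ≠ []) {y : ℤ → C} {z z' : ℤ → D}
    (h : ExtSeq τ y z) (h' : ExtSeq τ y z') : z = z' := by
  funext i
  obtain ⟨k, j, hj, rfl⟩ := exists_eq_cum_add (f := fun j => (τ (y j)).length)
    (fun j => List.length_pos_iff.2 (hτ _)) i
  exact eq_of_seg_eq ((h k).trans (h' k).symm) (by omega) (by omega)

lemma cum_add_eq_wordApply (τ : C → List D) (w : ℤ → C) (i : ℤ) (m : ℕ) :
    cum (fun j => (τ (w j)).length) (i + m) =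
      cum (fun j => (τ (w j)).length) i + (wordApply τ (seg w i m)).length := by
  induction m with
  | zero => simp
  | succ m ih =>
    rw [Nat.cast_succ, ← add_assoc, cum_add_one, ih, seg_add]
    simp [add_assoc]

lemma cum_comp {σ : B → List C} (τ : C → List D) {y : ℤ → B} {w : ℤ → C}
    (h : ExtSeq σ y w) (k : ℤ) :
    cum (fun j => (wordApply τ (σ (y j))).length) k =
      cum (fun j => (τ (w j)).length) (cum (fun j => (σ (y j)).length) k) := by
  have step : ∀ k, cum (fun j => (τ (w j)).length) (cum (fun j => (σ (y j)).length) (k + 1)) =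
      cum (fun j => (τ (w j)).length) (cum (fun j => (σ (y j)).length) k) +
        (wordApply τ (σ (y k))).length := fun k => by
    rw [cum_add_one, cum_add_eq_wordApply, h k]
  induction k using Int.induction_on with
  | zero => simp
  | succ k ih => rw [cum_add_one, step, ih]
  | pred k ih =>
    have h1 := step (-k - 1)
    have h2 := cum_add_one (fun j => (wordApply τ (σ (y j))).length) (-k - 1)
    rw [sub_add_cancel] at h1 h2
    omega

lemma ExtSeq.of_comp {σ : B → List C} {τ : C → List D} (hσ : ∀ b, σ b ≠ []) {y : ℤ → B}
    {w : ℤ → C} {z : ℤ → D} (hz : ExtSeq (fun b => wordApply τ (σ b)) y z)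
    (hw : ExtSeq σ y w) : ExtSeq τ w z := by
  intro i
  obtain ⟨k, j, hj, rfl⟩ := exists_eq_cum_add (f := fun j => (σ (y j)).length)
    (fun j => List.length_pos_iff.2 (hσ _)) i
  have hk : seg z _ (wordApply τ (σ (y k))).length = wordApply τ (σ (y k)) := hz k
  obtain ⟨s, hs⟩ : ∃ s, (σ (y k)).length = j + (1 + s) :=
    ⟨(σ (y k)).length - (j + 1), by omega⟩
  rw [cum_comp τ hw] at hk
  have hk' := hw k
  rw [hs, seg_add, seg_add, seg_one] at hk'
  rw [← hk'] at hk
  simp only [wordApply_append, wordApply_cons, wordApply_nil, List.append_nil,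
    List.length_append] at hk
  rw [seg_add, seg_add, ← cum_add_eq_wordApply] at hk
  exact (List.append_inj (List.append_inj hk (by simp)).2 (by simp)).1

end Extension

/-! ### Topology -/

section Topological

variable {B C : Type*} [TopologicalSpace B] [DiscreteTopology B]
  [TopologicalSpace C] [DiscreteTopology C]

lemma eventually_forall_mem_eq (x : ℤ → B) (s : Finset ℤ) :
    ∀ᶠ y in 𝓝 x, ∀ j ∈ s, y j = x j :=
  (Filter.eventually_all_finset s).2 fun j _ =>
    (continuous_apply j).continuousAt.eventually_mem ((isOpen_discrete {x j}).mem_nhds rfl)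

lemma eventually_seg_eq (x : ℤ → B) (i : ℤ) (m : ℕ) :
    ∀ᶠ y in 𝓝 x, seg y i m = seg x i m := by
  filter_upwards [eventually_forall_mem_eq x (Finset.Ico i (i + m))] with y hy
  rw [seg_eq_map, seg_eq_map]
  refine List.map_congr_left fun k hk => hy _ ?_
  have := List.mem_range.1 hk
  simp only [Finset.mem_Ico]
  omega

lemma isClosed_setOf_seg (P : List B → Prop) (i : ℤ) (m : ℕ) :
    IsClosed {x : ℤ → B | P (seg x i m)} := by
  refine isOpen_compl_iff.1 (isOpen_iff_eventually.2 fun x hx => ?_)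
  filter_upwards [eventually_seg_eq x i m] with y hy
  simpa [hy] using hx

lemma isClosed_setOf_extSeq (τ : B → List C) :
    IsClosed {p : (ℤ → B) × (ℤ → C) | ExtSeq τ p.1 p.2} := by
  simp only [ExtSeq, Set.ofPred_forall]
  refine isClosed_iInter fun k => isOpen_compl_iff.1 (isOpen_iff_eventually.2 fun p hp => ?_)
  filter_upwards
    [continuous_fst.continuousAt.eventually
      (eventually_forall_mem_eq p.1 (Finset.Icc (-|k|) |k|)),
    continuous_snd.continuousAt.eventually
      (eventually_seg_eq p.2 (cum (fun j => (τ (p.1 j)).length) k) (τ (p.1 k)).length)]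
    with q h1 h2
  have hk : q.1 k = p.1 k := h1 k (by simp [neg_abs_le, le_abs_self])
  have hc : cum (fun j => (τ (q.1 j)).length) k = cum (fun j => (τ (p.1 j)).length) k :=
    cum_congr fun j hj => by rw [h1 j hj]
  simpa [hk, hc, h2] using hp

omit [TopologicalSpace B] [DiscreteTopology B] in
/-- A factor-closed language with arbitrarily long words over a finite alphabet is the set of
possible factors of some biinfinite sequence. -/
lemma exists_forall_seg_mem [Finite B] [Nonempty B] {L : Set (List B)}
    (hL : ∀ u v, u <:+: v → v ∈ L → u ∈ L) (hlen : ∀ N, ∃ w ∈ L, N ≤ w.length) :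
    ∃ z : ℤ → B, ∀ i m, seg z i m ∈ L := by
  let _ : TopologicalSpace B := ⊥
  have _ : DiscreteTopology B := ⟨rfl⟩
  have hclosed : ∀ N : ℕ, IsClosed {z : ℤ → B | seg z (-N) (2 * N + 1) ∈ L} :=
    fun N => isClosed_setOf_seg (· ∈ L) _ _
  obtain ⟨z, hz⟩ := IsCompact.nonempty_iInter_of_sequence_nonempty_isCompact_isClosed
    (fun N : ℕ => {z : ℤ → B | seg z (-N) (2 * N + 1) ∈ L})
    (fun N z hz => hL _ _ (seg_infix_seg z (by omega) (by omega)) hz)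
    (fun N => by
      obtain ⟨w, hw, hN⟩ := hlen (2 * N + 1)
      obtain ⟨z, hz⟩ := exists_seg_eq w (-N)
      refine ⟨z, hL _ w ?_ hw⟩
      conv_rhs => rw [← hz]
      exact seg_infix_seg z le_rfl (by omega))
    (hclosed 0).isCompact hclosed
  refine ⟨z, fun i m => ?_⟩
  refine hL _ _ ?_ (Set.mem_iInter.1 hz (i.natAbs + m))
  exact seg_infix_seg z (by omega) (by omega)

omit [DiscreteTopology B] in
lemma continuous_shiftBy (p : ℤ) : Continuous (shiftBy p : (ℤ → B) → ℤ → B) :=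
  continuous_pi fun i => continuous_apply (i + p)

end Topological

/-! ### Directive sequences -/

section Directive

variable {A : ℕ → Type*} (σ : ∀ n, A (n + 1) → List (A n)) (a : ∀ n, A n)

lemma down_succ (k : ℕ) (c : A (k + 1)) :
    down σ (k + 1) c = wordApply (down σ k) (σ k c) := rfl

lemma down_ne_nil {σ : ∀ n, A (n + 1) → List (A n)} (hσ : ∀ n c, σ n c ≠ []) (k : ℕ)
    (c : A k) : down σ k c ≠ [] := by
  induction k with
  | zero => simp [down]
  | succ k ih =>
    rw [← List.length_pos_iff, down_succ]
    exact (List.length_pos_iff.2 (hσ k c)).trans_le (length_le_length_wordApply ih _)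

lemma down_add (n j : ℕ) (c : A (n + j)) :
    down σ (n + j) c =
      wordApply (down σ n) (down (A := fun j => A (n + j)) (fun j => σ (n + j)) j c) := by
  induction j with
  | zero => simp [down]
  | succ j ih =>
    change wordApply (down σ (n + j)) (σ (n + j) c) =
      wordApply (down σ n) (wordApply _ (σ (n + j) c))
    rw [wordApply_wordApply]
    exact congrArg (wordApply · _) (funext ih)

lemma length_down_zero_add (k : ℕ) (c : A k) :
    (down (A := fun j => A (0 + j)) (fun j => σ (0 + j)) k
      (cast (congrArg A (zero_add k).symm) c)).length = (down σ k c).length := by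
  induction k with
  | zero => simp [down]
  | succ k ih =>
    have hσ : ∀ (m : ℕ) (h : m = k), σ m (cast (congrArg A (by rw [h])) c) =
        (σ k c).map (cast (congrArg A h.symm)) := by
      rintro m rfl
      exact (List.map_id _).symm
    simp only [down, hσ (0 + k) (zero_add k), List.length_flatten, List.map_map]
    exact congrArg List.sum (List.map_congr_left fun b _ => ih b)

variable {σ a} [∀ n, Finite (A n)]

/-- If the subshift is nonempty, the generating words of every level are arbitrarily long. -/
lemma exists_le_length_down (hne : (XX σ a 0).Nonempty) (n N : ℕ) :
    ∃ j ≥ N, N ≤ (down (A := fun j => A (n + j)) (fun j => σ (n + j)) j (a (n + j))).length := by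
  obtain ⟨x, hx⟩ := hne
  obtain ⟨M, hM⟩ : ∃ M, ∀ c, (down σ n c).length ≤ M :=
    (Set.finite_range fun c => (down σ n c).length).bddAbove.imp fun M hM c => hM ⟨c, rfl⟩
  set Q := ∑ k ∈ Finset.range (n + N), (down σ k (a k)).length
  obtain ⟨k, hk⟩ := hx 0 (Q + M * N + 1)
  have hk := hk.length_le
  have ha : a (0 + k) = cast (congrArg A (zero_add k).symm) (a k) := by
    have : ∀ m (h : m = k), a m = cast (congrArg A h.symm) (a k) := by
      rintro m rfl
      rfl
    exact this _ (zero_add k)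
  rw [length_seg, ha, length_down_zero_add] at hk
  have hnk : n + N ≤ k := by
    by_contra! hlt
    have := Finset.single_le_sum (f := fun k => (down σ k (a k)).length)
      (fun _ _ => Nat.zero_le _) (Finset.mem_range.2 hlt)
    omega
  obtain ⟨j, rfl⟩ := Nat.exists_eq_add_of_le (le_trans (Nat.le_add_right n N) hnk)
  refine ⟨j, by omega, ?_⟩
  rw [down_add] at hk
  have := hk.trans (length_wordApply_le hM _)
  exact (lt_of_mul_lt_mul_left (by omega : M * N < M * _) (Nat.zero_le M)).le

lemma XX_nonempty [∀ n, Nonempty (A n)] (hne : (XX σ a 0).Nonempty) (n : ℕ) :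
    (XX σ a n).Nonempty := by
  obtain ⟨z, hz⟩ := exists_forall_seg_mem (B := A n)
    (L := {u | ∃ k, u <:+: down (A := fun j => A (n + j)) (fun j => σ (n + j)) k (a (n + k))})
    (fun u v huv ⟨k, hk⟩ => ⟨k, huv.trans hk⟩)
    (fun N => by
      obtain ⟨j, -, hj⟩ := exists_le_length_down hne n N
      exact ⟨_, ⟨j, List.infix_rfl⟩, hj⟩)
  exact ⟨z, hz⟩

omit [∀ n, Finite (A n)] in
lemma isClosed_XX [∀ n, TopologicalSpace (A n)] [∀ n, DiscreteTopology (A n)] (n : ℕ) :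
    IsClosed (XX σ a n) := by
  simp only [XX, Set.ofPred_forall]
  exact isClosed_iInter fun i => isClosed_iInter fun m =>
    isClosed_setOf_seg (fun u => ∃ k, u <:+:
      down (A := fun j => A (n + j)) (fun j => σ (n + j)) k (a (n + k))) i m

end Directive

/-- The set `τ_k(X k)`, where `τ_k = σ 0 ∘ ⋯ ∘ σ (k-1)`. -/
def towerBase {A : ℕ → Type*} (σ : ∀ n, A (n + 1) → List (A n)) (a : ∀ n, A n) (k : ℕ) :
    Set (ℤ → A 0) :=
  {z | ∃ y ∈ XX σ a k, ExtSeq (down σ k) y z}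

section TowerBase

variable {A : ℕ → Type*} {σ : ∀ n, A (n + 1) → List (A n)} {a : ∀ n, A n}

lemma iUnion_atom_zero (k : ℕ) : ⋃ c, Atom σ a k c 0 = towerBase σ a k := by
  have h0 : ∀ z : ℤ → A 0, shiftBy ((0 : ℕ) : ℤ) z = z := fun z => by
    funext i
    simp [shiftBy]
  ext x
  simp only [Set.mem_iUnion, Atom, towerBase, Set.mem_ofPred_eq, h0]
  constructor
  · rintro ⟨c, y, z, hy, -, hz, rfl⟩
    exact ⟨y, hy, hz⟩
  · rintro ⟨y, hy, hx⟩
    exact ⟨y 0, y, x, hy, rfl, hx, rfl⟩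

lemma towerBase_zero_subset : towerBase σ a 0 ⊆ XX σ a 0 := by
  rintro z ⟨y, hy, hz⟩
  have hcum : ∀ k, cum (fun _ => 1) k = k := fun k => by
    induction k using Int.induction_on with
    | zero => simp
    | succ k ih => rw [cum_add_one, ih, Nat.cast_one]
    | pred k ih =>
      have := cum_add_one (fun _ => 1) (-k - 1)
      rw [sub_add_cancel, ih] at this
      push_cast at this
      omega
  have : z = y := funext fun k => by
    simpa [down, hcum] using hz k
  rwa [this]

lemma towerBase_succ_subset (hσ : ∀ n c, σ n c ≠ [])
    (hwd : ∀ n, ∀ y ∈ XX σ a (n + 1), ∀ z, ExtSeq (σ n) y z → z ∈ XX σ a n) (k : ℕ) :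
    towerBase σ a (k + 1) ⊆ towerBase σ a k := by
  rintro z ⟨y, hy, hz⟩
  obtain ⟨w, hw⟩ := exists_extSeq (hσ k) y
  exact ⟨w, hwd k y hy w hw, ExtSeq.of_comp (hσ k) hz hw⟩

lemma towerBase_subset (hσ : ∀ n c, σ n c ≠ [])
    (hwd : ∀ n, ∀ y ∈ XX σ a (n + 1), ∀ z, ExtSeq (σ n) y z → z ∈ XX σ a n) (k : ℕ) :
    towerBase σ a k ⊆ XX σ a 0 :=
  (antitone_nat_of_succ_le (towerBase_succ_subset hσ hwd) (Nat.zero_le k)).trans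
    towerBase_zero_subset

lemma towerBase_nonempty [∀ n, Finite (A n)] [∀ n, Nonempty (A n)] (hσ : ∀ n c, σ n c ≠ [])
    (hne : (XX σ a 0).Nonempty) (k : ℕ) : (towerBase σ a k).Nonempty := by
  obtain ⟨y, hy⟩ := XX_nonempty hne k
  obtain ⟨z, hz⟩ := exists_extSeq (down_ne_nil hσ k) y
  exact ⟨z, y, hy, hz⟩

lemma isCompact_towerBase [∀ n, Finite (A n)] [∀ n, TopologicalSpace (A n)]
    [∀ n, DiscreteTopology (A n)] (k : ℕ) : IsCompact (towerBase σ a k) := by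
  have h : IsClosed {p : (ℤ → A k) × (ℤ → A 0) | p.1 ∈ XX σ a k ∧ ExtSeq (down σ k) p.1 p.2} :=
    ((isClosed_XX k).preimage continuous_fst).inter (isClosed_setOf_extSeq _)
  convert h.isCompact.image continuous_snd
  ext z
  simp [towerBase]

/-- Points of `τ_{k+1}(X (k+1))` have a common factor on each side of the origin. -/
lemma seg_eq_of_mem_towerBase_succ (hσ : ∀ n c, σ n c ≠ []) {k : ℕ} {l r : A k}
    (hl : ∀ c, (σ k c).head? = some l) (hr : ∀ c, (σ k c).getLast? = some r)
    {z : ℤ → A 0} (hz : z ∈ towerBase σ a (k + 1)) :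
    seg z 0 (down σ k l).length = down σ k l ∧
      seg z (-(down σ k r).length) (down σ k r).length = down σ k r := by
  obtain ⟨y, -, hz⟩ := hz
  obtain ⟨w, hw⟩ := exists_extSeq (hσ k) y
  have h : ExtSeq (down σ k) w z := ExtSeq.of_comp (hσ k) hz hw
  have hcum : ∀ f : ℤ → ℕ, cum f (-1) = -f (-1) := fun f => by
    have := cum_add_one f (-1)
    rw [neg_add_cancel, cum_zero] at this
    omega
  have h0 : w 0 = l := by
    obtain ⟨m, hm⟩ := Nat.exists_eq_add_one_of_ne_zero
      (List.length_pos_iff.2 (hσ k (y 0))).ne'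
    have hl0 := hl (y 0)
    rw [← hw 0, hm, cum_zero, add_comm, seg_add] at hl0
    simpa using hl0
  have h1 : w (-1) = r := by
    obtain ⟨m, hm⟩ := Nat.exists_eq_add_one_of_ne_zero
      (List.length_pos_iff.2 (hσ k (y (-1)))).ne'
    have hr1 := hr (y (-1))
    rw [← hw (-1), hcum, hm, seg_add] at hr1
    simpa using hr1
  have e0 := h 0
  have e1 := h (-1)
  rw [cum_zero, h0] at e0
  rw [hcum, h1] at e1
  exact ⟨e0, e1⟩

end TowerBase

/-! ### Growth of the images of letters -/

section Growth

variable {A : ℕ → Type*} {σ : ∀ n, A (n + 1) → List (A n)}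

lemma down_eq_singleton {l : ∀ n, A n} (hst : ∀ j, σ j (l (j + 1)) = [l j]) (j : ℕ) :
    down σ j (l j) = [l 0] := by
  induction j with
  | zero => rfl
  | succ j ih => simp [down_succ, hst, ih]

/-- If each `σ j` maps `l (j+1)` to `[l j]` and all images start with `l j`, then the image of any
letter is either a power of `l 0` or starts with a long power of `l 0`. -/
lemma forall_mem_down_eq_or_replicate_prefix {l : ∀ n, A n}
    (hl : ∀ n c, (σ n c).head? = some (l n)) (hst : ∀ j, σ j (l (j + 1)) = [l j])
    (j : ℕ) (c : A j) :
    (∀ b ∈ down σ j c, b = l 0) ∨ List.replicate j (l 0) <+: down σ j c := by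
  induction j with
  | zero => exact .inr (by simp)
  | succ j ih =>
    have key : ∀ w, (∀ b ∈ wordApply (down σ j) w, b = l 0) ∨
        List.replicate (j + 1) (l 0) <+: l 0 :: wordApply (down σ j) w := by
      intro w
      induction w with
      | nil => simp
      | cons d w ihw =>
        rcases ih d with hd | hd
        · rw [wordApply_cons]
          rcases ihw with hw | ⟨t, ht⟩
          · refine .inl fun b hb => ?_
            rcases List.mem_append.1 hb with hb | hb
            exacts [hd b hb, hw b hb]
          · refine .inr ⟨List.replicate (down σ j d).length (l 0) ++ t, ?_⟩
            have hcomm : ∀ m, l 0 :: (List.replicate m (l 0) ++ wordApply (down σ j) w) =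
                List.replicate m (l 0) ++ l 0 :: wordApply (down σ j) w := fun m => by
              rw [← List.cons_append, ← List.replicate_succ, List.replicate_succ',
                List.append_assoc, List.singleton_append]
            rw [List.eq_replicate_of_mem hd, List.length_replicate, hcomm, ← ht,
              ← List.append_assoc, ← List.append_assoc, List.replicate_append_replicate,
              List.replicate_append_replicate, add_comm]
        · refine .inr ?_
          rw [List.replicate_succ, wordApply_cons, ← List.cons_append]
          exact (List.cons_prefix_cons.2 ⟨rfl, hd⟩).trans (List.prefix_append _ _)
    obtain ⟨w, hw⟩ := List.head?_eq_some_iff.1 (hl j c)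
    rw [down_succ, hw, wordApply_cons, down_eq_singleton hst, List.singleton_append]
    exact (key w).imp (fun h => by simpa using h) id

/-- If the lengths of the images of the letters `b k` stay bounded, then `b (k+1)` is eventually
mapped to `[b k]`. -/
lemma exists_stationary_of_length_le (hσ : ∀ n c, σ n c ≠ []) {b : ∀ n, A n}
    (hb : ∀ n, b n ∈ σ n (b (n + 1))) {N : ℕ} (hN : ∀ k, (down σ k (b k)).length ≤ N) :
    ∃ n, ∀ k ≥ n, σ k (b (k + 1)) = [b k] := by
  have hstep : ∀ k, (down σ k (b k)).length + (σ k (b (k + 1))).length ≤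
      (down σ (k + 1) (b (k + 1))).length + 1 := fun k => by
    obtain ⟨s, t, hst⟩ := List.append_of_mem (hb k)
    have hs := length_le_length_wordApply (down_ne_nil hσ k) s
    have ht := length_le_length_wordApply (down_ne_nil hσ k) t
    rw [down_succ, hst]
    simp only [wordApply_append, wordApply_cons, List.length_append, List.length_cons]
    omega
  have hmono : Monotone fun k => (down σ k (b k)).length := monotone_nat_of_le_succ fun k => by
    have := hstep k
    have := List.length_pos_iff.2 (hσ k (b (k + 1)))
    omega
  have hbdd : BddAbove (Set.range fun k => (down σ k (b k)).length) :=
    ⟨N, Set.forall_mem_range.2 hN⟩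
  obtain ⟨n, hn⟩ := Nat.sSup_mem (Set.range_nonempty _) hbdd
  refine ⟨n, fun k hk => ?_⟩
  have h1 := hmono hk
  have h2 : (down σ (k + 1) (b (k + 1))).length ≤ (down σ n (b n)).length :=
    (le_csSup hbdd ⟨k + 1, rfl⟩).trans_eq hn.symm
  have h3 := hstep k
  have h4 := List.length_pos_iff.2 (hσ k (b (k + 1)))
  obtain ⟨c, hc⟩ := List.length_eq_one_iff.1
    (show (σ k (b (k + 1))).length = 1 by simp only at h1; omega)
  have := hb k
  rw [hc, List.mem_singleton] at this
  rw [hc, this]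

variable {a : ∀ n, A n}

lemma shiftBy_eq_of_extSeq_const {B C : Type*} {τ : B → List C} (hτ : ∀ c, τ c ≠ []) {b : B}
    {z : ℤ → C} (hz : ExtSeq τ (fun _ => b) z) : shiftBy ((τ b).length : ℤ) z = z := by
  refine ExtSeq.unique hτ (y := fun _ => b) (fun k => ?_) hz
  have h := hz (k + 1)
  rw [cum_add_one] at h
  rw [seg_shiftBy]
  exact h

/-- In a minimal non-periodic subshift, the common first letters are not eventually mapped to
single letters. -/
lemma not_stationary [∀ n, Finite (A n)] [∀ n, TopologicalSpace (A n)]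
    [∀ n, DiscreteTopology (A n)] (hσ : ∀ n c, σ n c ≠ [])
    (hmin : ∀ x ∈ XX σ a 0, XX σ a 0 ⊆ closure { z | ∃ p : ℤ, z = shiftBy p x })
    (hnonper : ∃ x ∈ XX σ a 0, ∀ p : ℕ, 1 ≤ p → shiftBy (p : ℤ) x ≠ x)
    (hwd : ∀ n, ∀ y ∈ XX σ a (n + 1), ∀ z, ExtSeq (σ n) y z → z ∈ XX σ a n)
    {l : ∀ n, A n} (hl : ∀ n c, (σ n c).head? = some (l n)) (n : ℕ) :
    ¬ ∀ k ≥ n, σ k (l (k + 1)) = [l k] := by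
  intro hst
  obtain ⟨x, hx, hper⟩ := hnonper
  have hconst : (fun _ => l n) ∈ XX σ a n := by
    intro i m
    obtain ⟨j, hj, hlen⟩ := exists_le_length_down ⟨x, hx⟩ n m
    refine ⟨j, ?_⟩
    rw [seg_const]
    rcases forall_mem_down_eq_or_replicate_prefix (A := fun j => A (n + j))
      (σ := fun j => σ (n + j)) (l := fun j => l (n + j)) (fun j => hl (n + j))
      (fun j => hst (n + j) (Nat.le_add_right n j)) j (a (n + j)) with h | h
    · rw [List.eq_replicate_of_mem h]
      exact (List.prefix_replicate_iff.2 ⟨by simpa using hlen, by simp⟩).isInfix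
    · refine List.IsInfix.trans ?_ h.isInfix
      exact (List.prefix_replicate_iff.2 ⟨by simpa using hj, by simp⟩).isInfix
  obtain ⟨z, hz⟩ := exists_extSeq (down_ne_nil hσ n) fun _ => l n
  have hzX : z ∈ XX σ a 0 := towerBase_subset hσ hwd n ⟨_, hconst, hz⟩
  have hzp := shiftBy_eq_of_extSeq_const (down_ne_nil hσ n) hz
  set p := (down σ n (l n)).length
  refine hper p (List.length_pos_iff.2 (down_ne_nil hσ n (l n))) ?_
  have hclosed : IsClosed {x : ℤ → A 0 | shiftBy (p : ℤ) x = x} :=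
    isClosed_eq (continuous_shiftBy _) continuous_id
  refine closure_minimal ?_ hclosed (hmin z hzX hx)
  rintro _ ⟨q, rfl⟩
  funext i
  have := congrFun hzp (i + q)
  simpa only [shiftBy, add_right_comm] using this

end Growth

/-- Let `X = XX σ a 0` be the minimal non-periodic S-adic subshift defined by a
directive sequence of proper morphisms whose concatenation extensions are one-to-one,
and let `τ_k = σ 0 ∘ ⋯ ∘ σ (k-1)`.  Then the intersection
`⋂_{k ≥ 1} ⋃_{c ∈ A k} τ_k([c])` consists of exactly one point of `X`. -/
theorem sadic_tower_intersection_singleton {A : ℕ → Type*} [∀ n, Fintype (A n)]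
    [∀ n, Nonempty (A n)] [∀ n, TopologicalSpace (A n)] [∀ n, DiscreteTopology (A n)]
    (σ : ∀ n, A (n + 1) → List (A n)) (a : ∀ n, A n)
    (hproper : ∀ n, ProperMorphism (σ n))
    (hmin : ∀ x ∈ XX σ a 0, XX σ a 0 ⊆ closure { z | ∃ p : ℤ, z = shiftBy p x })
    (hnonper : ∃ x ∈ XX σ a 0, ∀ p : ℕ, 1 ≤ p → shiftBy (p : ℤ) x ≠ x)
    (hwd : ∀ n, ∀ y ∈ XX σ a (n + 1), ∀ z, ExtSeq (σ n) y z → z ∈ XX σ a n)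
    (hinj : ∀ n, ∀ y ∈ XX σ a (n + 1), ∀ y' ∈ XX σ a (n + 1), ∀ z,
      ExtSeq (σ n) y z → ExtSeq (σ n) y' z → y = y') :
    ∃ x₀ : ℤ → A 0, x₀ ∈ XX σ a 0 ∧
      (⋂ k : ℕ, ⋃ c : A (k + 1), Atom σ a (k + 1) c 0) = {x₀} := by
  choose l r hlr using hproper
  have hl : ∀ n c, (σ n c).head? = some (l n) := fun n c => (hlr n c).1
  have hr : ∀ n c, (σ n c).getLast? = some (r n) := fun n c => (hlr n c).2
  have hσ : ∀ n c, σ n c ≠ [] := fun n c h => by simpa [h] using hl n c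
  have hns := not_stationary hσ hmin hnonper hwd hl
  have hgrowl : ∀ N, ∃ k, N < (down σ k (l k)).length := by
    by_contra! ⟨N, hN⟩
    obtain ⟨n, hn⟩ := exists_stationary_of_length_le hσ
      (fun n => List.mem_of_head? (hl n (l (n + 1)))) hN
    exact hns n hn
  have hgrowr : ∀ N, ∃ k, N < (down σ k (r k)).length := by
    by_contra! ⟨N, hN⟩
    obtain ⟨n, hn⟩ := exists_stationary_of_length_le hσ
      (fun n => List.mem_of_getLast? (hr n (r (n + 1)))) hN
    have hrl : ∀ k ≥ n, r k = l k := fun k hk => by simpa [hn k hk] using hl k (r (k + 1))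
    refine hns n fun k hk => ?_
    rw [← hrl k hk, ← hrl (k + 1) (by omega), hn k hk]
  obtain ⟨x, hx, -⟩ := hnonper
  obtain ⟨x₀, hx₀⟩ := IsCompact.nonempty_iInter_of_sequence_nonempty_isCompact_isClosed
    (fun k => towerBase σ a (k + 1)) (fun k => towerBase_succ_subset hσ hwd (k + 1))
    (fun k => towerBase_nonempty hσ ⟨x, hx⟩ (k + 1)) (isCompact_towerBase 1)
    (fun k => (isCompact_towerBase (k + 1)).isClosed)
  rw [Set.mem_iInter] at hx₀
  refine ⟨x₀, towerBase_subset hσ hwd 1 (hx₀ 0), ?_⟩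
  simp only [iUnion_atom_zero]
  refine Set.eq_singleton_iff_unique_mem.2 ⟨Set.mem_iInter.2 hx₀, fun x₁ hx₁ => ?_⟩
  rw [Set.mem_iInter] at hx₁
  funext i
  rcases le_or_gt 0 i with hi | hi
  · obtain ⟨k, hk⟩ := hgrowl i.natAbs
    have h₀ := (seg_eq_of_mem_towerBase_succ hσ (hl k) (hr k) (hx₀ k)).1
    have h₁ := (seg_eq_of_mem_towerBase_succ hσ (hl k) (hr k) (hx₁ k)).1
    exact eq_of_seg_eq (h₁.trans h₀.symm) hi (by omega)
  · obtain ⟨k, hk⟩ := hgrowr i.natAbs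
    have h₀ := (seg_eq_of_mem_towerBase_succ hσ (hl k) (hr k) (hx₀ k)).2
    have h₁ := (seg_eq_of_mem_towerBase_succ hσ (hl k) (hr k) (hx₁ k)).2
    exact eq_of_seg_eq (h₁.trans h₀.symm) (by omega) (by omega)
end

section
/- Let A be a finite alphabet and x ∈ A^ℕ. Then x is ultimately periodic if and only if there exists n ≥ 1 with p_x(n) ≤ n, where p_x(n) is the number of distinct factors of length n of x. (Morse–Hedlund theorem.) -/
/-- The factor `x_i x_{i+1} ⋯ x_{i+n-1}` of the infinite sequence `x`. -/
def segN {A : Type*} (x : ℕ → A) (i n : ℕ) : List A :=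
  (List.range n).map fun k => x (i + k)

/-- The set of factors of length `n` of the infinite sequence `x`. -/
def factors {A : Type*} (x : ℕ → A) (n : ℕ) : Set (List A) :=
  { w | ∃ i : ℕ, segN x i n = w }

/-- The word complexity of `x`: the number of distinct factors of length `n`. -/
noncomputable def complexityN {A : Type*} (x : ℕ → A) (n : ℕ) : ℕ :=
  (factors x n).ncard

theorem segN_eq_segN_iff {A : Type*} (x : ℕ → A) (i j n : ℕ) :
    segN x i n = segN x j n ↔ ∀ k < n, x (i + k) = x (j + k) := by
  simp [segN]

theorem dropLast_segN_succ {A : Type*} (x : ℕ → A) (i n : ℕ) :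
    (segN x i (n + 1)).dropLast = segN x i n := by
  simp [segN, List.range_succ]

theorem finite_factors {A : Type*} [Finite A] (x : ℕ → A) (n : ℕ) : (factors x n).Finite :=
  (List.finite_length_eq A n).subset <| by
    rintro _ ⟨i, rfl⟩
    simp [segN]

theorem factors_eq_image_dropLast {A : Type*} (x : ℕ → A) (n : ℕ) :
    factors x n = List.dropLast '' factors x (n + 1) := by
  ext w
  constructor
  · rintro ⟨i, rfl⟩
    exact ⟨_, ⟨i, rfl⟩, dropLast_segN_succ x i n⟩
  · rintro ⟨_, ⟨i, rfl⟩, rfl⟩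
    exact ⟨i, (dropLast_segN_succ x i n).symm⟩

theorem complexityN_zero {A : Type*} (x : ℕ → A) : complexityN x 0 = 1 := by
  have h : factors x 0 = {[]} := by
    ext w
    simp [factors, segN, eq_comm]
  simp [complexityN, h]

theorem segN_eq_of_periodic {A : Type*} {x : ℕ → A} {N p : ℕ}
    (h : ∀ k, N ≤ k → x (k + p) = x k) {i : ℕ} (hi : N ≤ i) (n : ℕ) :
    segN x (i + p) n = segN x i n := by
  rw [segN_eq_segN_iff]
  intro k _
  rw [← h (i + k) (by omega)]
  congr 1
  omega

theorem complexityN_le_of_periodic {A : Type*} {x : ℕ → A} {N p : ℕ} (hp : 1 ≤ p)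
    (h : ∀ k, N ≤ k → x (k + p) = x k) (n : ℕ) : complexityN x n ≤ N + p := by
  have hred : ∀ i, ∃ j < N + p, segN x j n = segN x i n := by
    intro i
    induction i using Nat.strong_induction_on with
    | _ i ih =>
      by_cases hi : i < N + p
      · exact ⟨i, hi, rfl⟩
      · obtain ⟨j, hj, hji⟩ := ih (i - p) (by omega)
        refine ⟨j, hj, hji.trans ?_⟩
        rw [← segN_eq_of_periodic h (by omega : N ≤ i - p), Nat.sub_add_cancel (by omega)]
  have hsub : factors x n ⊆ (segN x · n) '' Set.Iio (N + p) := by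
    rintro _ ⟨i, rfl⟩
    exact hred i
  calc complexityN x n ≤ _ := Set.ncard_le_ncard hsub ((Set.finite_Iio _).image _)
    _ ≤ _ := Set.ncard_image_le (Set.finite_Iio _)
    _ = N + p := by simp [Set.ncard_eq_toFinset_card']

theorem exists_complexityN_succ_le {A : Type*} {x : ℕ → A} {n : ℕ} (h : complexityN x n ≤ n) :
    ∃ m, complexityN x (m + 1) ≤ complexityN x m := by
  by_contra! hlt
  have hge : n + complexityN x 0 ≤ complexityN x n := (strictMono_nat_of_lt_succ hlt).add_le_nat n 0
  rw [complexityN_zero] at hge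
  omega

theorem exists_periodic_of_complexityN_succ_le {A : Type*} [Finite A] {x : ℕ → A} {m : ℕ}
    (h : complexityN x (m + 1) ≤ complexityN x m) :
    ∃ N p : ℕ, 1 ≤ p ∧ ∀ k, N ≤ k → x (k + p) = x k := by
  have hinj : Set.InjOn List.dropLast (factors x (m + 1)) := by
    refine Set.injOn_of_ncard_image_eq ?_ (finite_factors x _)
    rw [← factors_eq_image_dropLast]
    refine le_antisymm ?_ h
    rw [factors_eq_image_dropLast]
    exact Set.ncard_image_le (finite_factors x _)
  have hext : ∀ i j, segN x i m = segN x j m → segN x i (m + 1) = segN x j (m + 1) :=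
    fun i j hij => hinj ⟨i, rfl⟩ ⟨j, rfl⟩ (by simpa only [dropLast_segN_succ] using hij)
  obtain ⟨i, j, hlt, hij⟩ : ∃ i j, i < j ∧ segN x i m = segN x j m := by
    obtain ⟨i, -, j, -, hne, hij⟩ := Set.infinite_univ.exists_ne_map_eq_of_mapsTo
      (f := (segN x · m)) (t := factors x m) (fun i _ => ⟨i, rfl⟩) (finite_factors x m)
    rcases hne.lt_or_gt with hlt | hlt
    · exact ⟨i, j, hlt, hij⟩
    · exact ⟨j, i, hlt, hij.symm⟩
  have hshift : ∀ k, segN x (i + k) m = segN x (j + k) m := by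
    intro k
    induction k with
    | zero => exact hij
    | succ k ih =>
      have hk := (segN_eq_segN_iff ..).1 (hext _ _ ih)
      refine (segN_eq_segN_iff ..).2 fun l hl => ?_
      convert hk (l + 1) (by omega) using 2 <;> omega
  refine ⟨i, j - i, by omega, fun k hk => ?_⟩
  have hx := (segN_eq_segN_iff ..).1 (hext _ _ (hshift (k - i))) 0 (by omega)
  convert hx.symm using 2 <;> omega

/-- **Morse–Hedlund theorem.**  An infinite sequence `x` over a finite alphabet is
ultimately periodic if and only if `p_x(n) ≤ n` for some `n ≥ 1`. -/
theorem morse_hedlund {A : Type*} [Fintype A] (x : ℕ → A) :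
    (∃ (N : ℕ) (p : ℕ), 1 ≤ p ∧ ∀ k : ℕ, N ≤ k → x (k + p) = x k) ↔
      ∃ n : ℕ, 1 ≤ n ∧ complexityN x n ≤ n := by
  constructor
  · rintro ⟨N, p, hp, h⟩
    exact ⟨N + p, by omega, complexityN_le_of_periodic hp h _⟩
  · rintro ⟨n, -, hn⟩
    obtain ⟨m, hm⟩ := exists_complexityN_succ_le hn
    exact exists_periodic_of_complexityN_succ_le hm
end
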